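/- Let N be an open disk in ℂ and let a₀,…,a_s be holomorphic functions on N. For any z₀ ∈ N, the set of holomorphic solutions y on N of the linear ODE y^{(s+1)} + a_s y^{(s)} + ⋯ + a₁ y' + a₀ y = 0 forms a complex vector space of dimension s+1. -/

import Mathlib

/-- The solution predicate for the linear ODE
`y^{(s+1)} + a_s y^{(s)} + ⋯ + a₁ y' + a₀ y = 0` on the disk `N`. -/
def IsODESol (s : ℕ) (N : Set ℂ) (a : Fin (s + 1) → ℂ → ℂ) (y : ℂ → ℂ) : Prop :=
  DifferentiableOn ℂ y N ∧
    ∀ z ∈ N, iteratedDeriv (s + 1) y z + ∑ i : Fin (s + 1), a i z * iteratedDeriv (i : ℕ) y z = 0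

open Metric Set

section LinearSystem

variable {E : Type*} [NormedAddCommGroup E] [NormedSpace ℂ E]

theorem hasDerivAt_comp_segment {g g' : ℂ → E} {z₀ z : ℂ} {t : ℝ}
    (hg : HasDerivAt g (g' (z₀ + t * (z - z₀))) (z₀ + t * (z - z₀))) :
    HasDerivAt (fun t : ℝ => g (z₀ + t * (z - z₀)))
      ((z - z₀) • g' (z₀ + t * (z - z₀))) t := by
  have h : HasDerivAt (fun t : ℝ => z₀ + (t : ℂ) * (z - z₀)) (z - z₀) t := by
    simpa using ((Complex.ofRealCLM.hasDerivAt (x := t)).mul_const (z - z₀)).const_add z₀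
  exact hg.scomp t h

theorem segment_mem {S : Set ℂ} (hS : Convex ℝ S) {z₀ z : ℂ} (hz₀ : z₀ ∈ S) (hz : z ∈ S)
    {t : ℝ} (ht : t ∈ Icc (0 : ℝ) 1) : z₀ + t * (z - z₀) ∈ S := by
  simpa using hS.add_smul_sub_mem hz₀ hz ht

theorem norm_le_pow_succ_of_hasDerivAt {S : Set ℂ} (hS : Convex ℝ S) {z₀ : ℂ} (hz₀ : z₀ ∈ S)
    {g g' : ℂ → E} (hg : ∀ z ∈ S, HasDerivAt g (g' z) z) (hg₀ : g z₀ = 0) {C : ℝ} {n : ℕ}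
    (hC : ∀ z ∈ S, ‖g' z‖ ≤ C * ‖z - z₀‖ ^ n) {z : ℂ} (hz : z ∈ S) :
    ‖g z‖ ≤ C / (n + 1) * ‖z - z₀‖ ^ (n + 1) := by
  have hd : ∀ t ∈ Icc (0 : ℝ) 1, HasDerivAt (fun t : ℝ => g (z₀ + t * (z - z₀)))
      ((z - z₀) • g' (z₀ + t * (z - z₀))) t := fun t ht =>
    hasDerivAt_comp_segment (hg _ (segment_mem hS hz₀ hz ht))
  have key := image_norm_le_of_norm_deriv_right_le_deriv_boundary
    (fun t ht => (hd t ht).continuousAt.continuousWithinAt)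
    (fun t ht => (hd t (Ico_subset_Icc_self ht)).hasDerivWithinAt)
    (B := fun t => C / (n + 1) * ‖z - z₀‖ ^ (n + 1) * t ^ (n + 1))
    (B' := fun t => C / (n + 1) * ‖z - z₀‖ ^ (n + 1) * ((n + 1) * t ^ n)) (by simp [hg₀])
    (fun t => by simpa using (hasDerivAt_pow (n + 1) t).const_mul _)
    (fun t ht => by
      have h := hC _ (segment_mem hS hz₀ hz (Ico_subset_Icc_self ht))
      rw [add_sub_cancel_left, norm_mul, Complex.norm_real, Real.norm_of_nonneg ht.1] at h
      rw [norm_smul]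
      calc _ ≤ ‖z - z₀‖ * (C * (t * ‖z - z₀‖) ^ n) := by gcongr
        _ = _ := by rw [mul_pow, pow_succ]; field_simp)
    (right_mem_Icc.2 zero_le_one)
  simpa using key

theorem eqOn_zero_of_hasDerivAt_linear {S : Set ℂ} (hS : Convex ℝ S) {A : ℂ → E →L[ℂ] E}
    (hA : ContinuousOn A S) {z₀ : ℂ} (hz₀ : z₀ ∈ S) {w : ℂ → E}
    (hw : ∀ z ∈ S, HasDerivAt w (A z (w z)) z) (hw₀ : w z₀ = 0) : EqOn w 0 S := by
  intro z hz
  have hmem : MapsTo (fun t : ℝ => z₀ + t * (z - z₀)) (Icc 0 1) S :=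
    fun t ht => segment_mem hS hz₀ hz ht
  obtain ⟨M, hM⟩ := isCompact_Icc.exists_bound_of_continuousOn
    (hA.comp (by fun_prop : ContinuousOn (fun t : ℝ => z₀ + t * (z - z₀)) (Icc 0 1)) hmem)
  have hd : ∀ t ∈ Icc (0 : ℝ) 1, HasDerivAt (fun t : ℝ => w (z₀ + t * (z - z₀)))
      ((z - z₀) • A (z₀ + t * (z - z₀)) (w (z₀ + t * (z - z₀)))) t := fun t ht =>
    hasDerivAt_comp_segment (g' := fun z => A z (w z)) (hw _ (hmem ht))
  have key := eq_zero_of_abs_deriv_le_mul_abs_self_of_eq_zero_right (K := ‖z - z₀‖ * M)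
    (fun t ht => (hd t ht).continuousAt.continuousWithinAt)
    (fun t ht => (hd t (Ico_subset_Icc_self ht)).hasDerivWithinAt) (by simpa using hw₀)
    (fun t ht => by
      rw [norm_smul, mul_assoc]
      gcongr
      exact ContinuousLinearMap.le_of_opNorm_le _ (hM t (Ico_subset_Icc_self ht)) _) 1
    (right_mem_Icc.2 zero_le_one)
  simpa using key

theorem exists_hasDerivAt_linear_ball [CompleteSpace E] {c : ℂ} {R : ℝ} {A : ℂ → E →L[ℂ] E}
    (hA : DifferentiableOn ℂ A (ball c R)) {z₀ : ℂ} (hz₀ : z₀ ∈ ball c R) (v : E) :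
    ∃ w : ℂ → E, w z₀ = v ∧ ∀ z ∈ ball c R, HasDerivAt w (A z (w z)) z := by
  have hprim : ∀ f : ℂ → E, ∃ g : ℂ → E, DifferentiableOn ℂ f (ball c R) →
      g z₀ = 0 ∧ ∀ z ∈ ball c R, HasDerivAt g (f z) z := fun f => by
    by_cases hf : DifferentiableOn ℂ f (ball c R)
    · obtain ⟨g, hg⟩ := hf.isExactOn_ball.with_val_at z₀ 0
      exact ⟨g, fun _ => hg⟩
    · exact ⟨0, fun h => absurd h hf⟩
  choose P hP using hprim
  let u : ℕ → ℂ → E := fun n => Nat.rec (fun _ => v) (fun _ f => P fun z => A z (f z)) n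
  have hu : ∀ n, DifferentiableOn ℂ (u n) (ball c R) := fun n => by
    induction n with
    | zero => exact differentiableOn_const v
    | succ n ih =>
      exact fun z hz => ((hP _ (hA.clm_apply ih)).2 z hz).differentiableAt.differentiableWithinAt
  have hu₀ : ∀ n, u (n + 1) z₀ = 0 := fun n => (hP _ (hA.clm_apply (hu n))).1
  have hu' : ∀ n, ∀ z ∈ ball c R, HasDerivAt (u (n + 1)) (A z (u n z)) z :=
    fun n => (hP _ (hA.clm_apply (hu n))).2
  refine ⟨fun z => ∑' n, u n z, ?_, fun z hz => ?_⟩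
  · refine tsum_eq_single 0 fun n hn => ?_
    obtain ⟨m, rfl⟩ := Nat.exists_eq_succ_of_ne_zero hn
    exact hu₀ m
  obtain ⟨r, hr, hrR⟩ := exists_between (max_lt (mem_ball.1 hz₀) (mem_ball.1 hz))
  obtain ⟨hz₀r, hzr⟩ := max_lt_iff.1 hr
  obtain ⟨M, hM⟩ := (isCompact_closedBall c r).exists_bound_of_continuousOn
    (hA.continuousOn.mono (closedBall_subset_ball hrR))
  have hsub : ball c r ⊆ ball c R := ball_subset_ball hrR.le
  have hM0 : 0 ≤ M := (norm_nonneg _).trans (hM z (ball_subset_closedBall hzr))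
  have hbound : ∀ n, ∀ x ∈ ball c r,
      ‖u n x‖ ≤ ‖v‖ * M ^ n / n.factorial * ‖x - z₀‖ ^ n := fun n => by
    induction n with
    | zero => intro x _; simp [u]
    | succ n ih =>
      intro x hx
      refine (norm_le_pow_succ_of_hasDerivAt (convex_ball c r) hz₀r
        (fun y hy => hu' n y (hsub hy)) (hu₀ n) (n := n) (C := M * (‖v‖ * M ^ n / n.factorial))
        (fun y hy => ?_) hx).trans_eq ?_
      · rw [mul_assoc]
        exact ContinuousLinearMap.le_of_opNorm_le_of_le _
          (hM y (ball_subset_closedBall hy)) (ih y hy)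
      · rw [Nat.factorial_succ]
        push_cast
        field_simp
        ring
  have hbound' : ∀ n, ∀ x ∈ ball c r,
      ‖u n x‖ ≤ ‖v‖ * ((M * (r + r)) ^ n / n.factorial) := fun n x hx => by
    have hxz : ‖x - z₀‖ ≤ r + r := by
      rw [← dist_eq_norm]
      exact (dist_triangle_right x z₀ c).trans (add_le_add hx.le hz₀r.le)
    calc _ ≤ _ := hbound n x hx
      _ ≤ ‖v‖ * M ^ n / n.factorial * (r + r) ^ n := by gcongr
      _ = _ := by rw [mul_pow]; ring
  have hsum : Summable fun n : ℕ => ‖v‖ * ((M * (r + r)) ^ n / n.factorial) :=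
    (Real.summable_pow_div_factorial _).mul_left _
  have hsz : Summable fun n => u n z := .of_norm_bounded hsum fun n => hbound' n z hzr
  have hdiff := Complex.differentiableOn_tsum_of_summable_norm hsum
    (fun n => (hu n).mono hsub) isOpen_ball hbound'
  have hderiv := Complex.hasSum_deriv_of_summable_norm hsum
    (fun n => (hu n).mono hsub) isOpen_ball hbound' hzr
  have h0 : deriv (u 0) z = 0 := deriv_const z v
  have hs : HasSum (fun n => deriv (u n) z) (A z (∑' n, u n z)) := by
    rw [← hasSum_nat_add_iff' 1]
    simpa [h0, (hu' _ z hz).deriv] using hsz.hasSum.mapL (A z)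
  rw [← hderiv.unique hs]
  exact (hdiff.differentiableAt (isOpen_ball.mem_nhds hzr)).hasDerivAt

end LinearSystem

section Companion

variable {s : ℕ}

/-- The companion matrix, as a continuous linear map, of the scalar equation
`y^{(s+1)} + a_s y^{(s)} + ⋯ + a₀ y = 0`. -/
noncomputable def companionCLM (a : Fin (s + 1) → ℂ → ℂ) (z : ℂ) :
    (Fin (s + 1) → ℂ) →L[ℂ] (Fin (s + 1) → ℂ) :=
  ContinuousLinearMap.pi (Fin.lastCases (motive := fun _ => (Fin (s + 1) → ℂ) →L[ℂ] ℂ) 0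
    fun i => ContinuousLinearMap.proj i.succ) -
  ∑ j, a j z • (ContinuousLinearMap.single ℂ (fun _ : Fin (s + 1) => ℂ) (Fin.last s)).comp
    (ContinuousLinearMap.proj j)

theorem companionCLM_castSucc (a : Fin (s + 1) → ℂ → ℂ) (z : ℂ) (v : Fin (s + 1) → ℂ)
    (i : Fin s) : companionCLM a z v i.castSucc = v i.succ := by
  simp [companionCLM, Fin.castSucc_ne_last]

theorem companionCLM_last (a : Fin (s + 1) → ℂ → ℂ) (z : ℂ) (v : Fin (s + 1) → ℂ) :
    companionCLM a z v (Fin.last s) = -∑ j, a j z * v j := by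
  simp [companionCLM]

theorem differentiableOn_companionCLM {a : Fin (s + 1) → ℂ → ℂ} {N : Set ℂ}
    (ha : ∀ i, DifferentiableOn ℂ (a i) N) : DifferentiableOn ℂ (companionCLM a) N := by
  unfold companionCLM
  fun_prop

theorem IsODESol.hasDerivAt_jet {N : Set ℂ} (hN : IsOpen N) {a : Fin (s + 1) → ℂ → ℂ}
    {y : ℂ → ℂ} (hy : IsODESol s N a y) {z : ℂ} (hz : z ∈ N) :
    HasDerivAt (fun z => fun i : Fin (s + 1) => iteratedDeriv i y z)
      (companionCLM a z fun i => iteratedDeriv i y z) z := by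
  rw [hasDerivAt_pi]
  intro i
  have h : HasDerivAt (iteratedDeriv i y) (iteratedDeriv (i + 1) y z) z := by
    rw [iteratedDeriv_succ, iteratedDeriv_eq_iterate]
    exact ((hy.1.analyticOnNhd hN).iterated_deriv i z hz).differentiableAt.hasDerivAt
  refine h.congr_deriv ?_
  induction i using Fin.lastCases with
  | last => rw [companionCLM_last]; exact eq_neg_of_add_eq_zero_left (hy.2 z hz)
  | cast i => rw [companionCLM_castSucc]; rfl

theorem iteratedDeriv_eq_of_hasDerivAt_companionCLM {N : Set ℂ} (hN : IsOpen N)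
    {a : Fin (s + 1) → ℂ → ℂ} {w : ℂ → Fin (s + 1) → ℂ}
    (hw : ∀ z ∈ N, HasDerivAt w (companionCLM a z (w z)) z) (i : Fin (s + 1)) {z : ℂ}
    (hz : z ∈ N) : iteratedDeriv i (fun z => w z 0) z = w z i := by
  induction i using Fin.induction generalizing z with
  | zero => simp
  | succ i ih =>
    have h : iteratedDeriv (i : ℕ) (fun z => w z 0) =ᶠ[nhds z] fun z => w z i.castSucc :=
      Filter.eventuallyEq_of_mem (hN.mem_nhds hz) fun x hx => ih hx
    rw [Fin.val_succ, iteratedDeriv_succ, h.deriv_eq,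
      (hasDerivAt_pi.1 (hw z hz) i.castSucc).deriv, companionCLM_castSucc]

theorem isODESol_of_hasDerivAt_companionCLM {N : Set ℂ} (hN : IsOpen N)
    {a : Fin (s + 1) → ℂ → ℂ} {w : ℂ → Fin (s + 1) → ℂ}
    (hw : ∀ z ∈ N, HasDerivAt w (companionCLM a z (w z)) z) :
    IsODESol s N a fun z => w z 0 := by
  refine ⟨fun z hz => (hasDerivAt_pi.1 (hw z hz) 0).differentiableAt.differentiableWithinAt,
    fun z hz => ?_⟩
  have h : iteratedDeriv s (fun z => w z 0) =ᶠ[nhds z] fun z => w z (Fin.last s) :=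
    Filter.eventuallyEq_of_mem (hN.mem_nhds hz) fun x hx =>
      iteratedDeriv_eq_of_hasDerivAt_companionCLM hN hw (Fin.last s) hx
  rw [iteratedDeriv_succ, h.deriv_eq, (hasDerivAt_pi.1 (hw z hz) (Fin.last s)).deriv,
    companionCLM_last]
  simp [iteratedDeriv_eq_of_hasDerivAt_companionCLM hN hw _ hz]

end Companion

/-- on an open disk `N`, with holomorphic coefficients `a₀, …, a_s`, the
holomorphic solutions of the linear ODE of order `s+1` form a complex vector space of
dimension `s+1`: there is a basis `Y₀, …, Y_s` of solutions (normalized by initial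
conditions at `z₀ ∈ N`) such that every solution is, on `N`, a unique linear
combination of the `Y i`. -/
theorem stmt0 (s : ℕ) (c : ℂ) (R : ℝ) (hR : 0 < R)
    (a : Fin (s + 1) → ℂ → ℂ)
    (ha : ∀ i, DifferentiableOn ℂ (a i) (Metric.ball c R))
    (z₀ : ℂ) (hz₀ : z₀ ∈ Metric.ball c R) :
    ∃ Y : Fin (s + 1) → ℂ → ℂ,
      (∀ i, IsODESol s (Metric.ball c R) a (Y i)) ∧
      (∀ i j : Fin (s + 1), iteratedDeriv (i : ℕ) (Y j) z₀ = if i = j then 1 else 0) ∧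
      ∀ y, IsODESol s (Metric.ball c R) a y →
        ∃! k : Fin (s + 1) → ℂ,
          Set.EqOn y (fun z => ∑ i : Fin (s + 1), k i * Y i z) (Metric.ball c R) := by
  have hN : IsOpen (ball c R) := isOpen_ball
  have hA := differentiableOn_companionCLM ha
  choose W hW₀ hW using fun j : Fin (s + 1) =>
    exists_hasDerivAt_linear_ball hA hz₀ (Pi.single j (1 : ℂ))
  have hinit : ∀ i j : Fin (s + 1),
      iteratedDeriv (i : ℕ) (fun z => W j z 0) z₀ = if i = j then 1 else 0 := fun i j => by
    rw [iteratedDeriv_eq_of_hasDerivAt_companionCLM hN (hW j) i hz₀, hW₀, Pi.single_apply]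
  have hsol := fun j => isODESol_of_hasDerivAt_companionCLM hN (hW j)
  refine ⟨fun j z => W j z 0, hsol, hinit, fun y hy => ?_⟩
  refine ⟨fun i => iteratedDeriv i y z₀, fun z hz => ?_, fun k hk => funext fun i => ?_⟩
  · have hzero := eqOn_zero_of_hasDerivAt_linear (convex_ball c R) hA.continuousOn hz₀
      (w := fun z => (fun i : Fin (s + 1) => iteratedDeriv i y z) -
        ∑ j : Fin (s + 1), iteratedDeriv j y z₀ • W j z)
      (fun z hz => by
        rw [map_sub, map_sum]
        simp only [map_smul]
        exact (hy.hasDerivAt_jet hN hz).sub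
          (HasDerivAt.fun_sum fun j _ => (hW j z hz).const_smul (iteratedDeriv j y z₀)))
      (by
        ext i
        simp [hW₀, Pi.single_apply])
    simpa [sub_eq_zero] using congrFun (hzero hz) 0
  · have h := (Filter.eventuallyEq_of_mem (hN.mem_nhds hz₀) hk).iteratedDeriv_eq (i : ℕ)
    rw [iteratedDeriv_fun_sum fun j _ => contDiffAt_const.mul
      (((hsol j).1.analyticOnNhd hN z₀ hz₀).contDiffAt)] at h
    simpa [hinit] using h.symm
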